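/- Let X, Y be locally compact Hausdorff spaces and F a bilinear functional on C₀(X) × C₀(Y) (compactly supported continuous functions) such that for every pair of compact sets K₁ ⊆ X, K₂ ⊆ Y there is a constant C(K₁,K₂) with |F(f,g)| ≤ C(K₁,K₂)‖f‖_∞‖g‖_∞ for all f supported in K₁ and g supported in K₂, and F(f,g) ≥ 0 whenever f, g ≥ 0. Then there exists a nonnegative Radon measure μ on X × Y, finite on compact sets, such that F(f,g) = ∫_{X×Y} f(x)g(y) dμ(x,y) for all f ∈ C₀(X), g ∈ C₀(Y). -/

import Mathlib

open MeasureTheory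
open scoped CompactlySupported

open CompactlySupportedContinuousMap
open scoped ENNReal TensorProduct

section Algebra

variable {V E : Type*} [AddCommGroup V] [Module ℝ V] [AddCommGroup E] [Module ℝ E]

/-- **M. Riesz extension theorem** along a linear map: a functional `L` on `V` that is nonnegative
on the preimage of a cone `s` factors through `T : V → E` as a functional nonnegative on `s`,
provided the range of `T` is cofinal for `s`. -/
theorem PointedCone.exists_nonneg_comp_eq (s : PointedCone ℝ E) (T : V →ₗ[ℝ] E) (L : V →ₗ[ℝ] ℝ)
    (nonneg : ∀ v, T v ∈ s → 0 ≤ L v) (cofinal : ∀ y, ∃ v, T v + y ∈ s) :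
    ∃ G : E →ₗ[ℝ] ℝ, (∀ v, G (T v) = L v) ∧ ∀ x ∈ s, 0 ≤ G x := by
  have hker : L ∈ (LinearMap.ker T).dualAnnihilator := by
    rw [Submodule.mem_dualAnnihilator]
    intro v hv
    rw [LinearMap.mem_ker] at hv
    have h₁ := nonneg v (by simp [hv])
    have h₂ := nonneg (-v) (by simp [hv])
    rw [map_neg] at h₂
    linarith
  rw [← LinearMap.range_dualMap_eq_dualAnnihilator_ker] at hker
  obtain ⟨L', rfl⟩ := hker
  obtain ⟨G, hG, hG'⟩ := riesz_extension s ⟨LinearMap.range T, L'.domRestrict (LinearMap.range T)⟩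
    (by rintro ⟨_, v, rfl⟩ hv; exact nonneg v hv)
    (fun y ↦ (cofinal y).elim fun v hv ↦ ⟨⟨T v, v, rfl⟩, hv⟩)
  exact ⟨G, fun v ↦ hG ⟨T v, v, rfl⟩, hG'⟩

end Algebra

section Measure

variable {Z : Type*} [TopologicalSpace Z] [T2Space Z] [MeasurableSpace Z] [BorelSpace Z]

/-- The inner regularization of a measure: the measure of a measurable set `s` is the supremum of
the measures of `s ∩ K` over compact sets `K`. -/
noncomputable def MeasureTheory.Measure.compactPart (μ : Measure Z) : Measure Z :=
  Measure.ofMeasurable (fun s _ ↦ ⨆ K : TopologicalSpace.Compacts Z, μ (s ∩ K)) (by simp) <| by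
    intro s hs hd
    have hK (K : TopologicalSpace.Compacts Z) : μ ((⋃ i, s i) ∩ K) = ∑' i, μ (s i ∩ K) := by
      rw [Set.iUnion_inter, measure_iUnion
        (fun i j hij ↦ (hd hij).mono Set.inter_subset_left Set.inter_subset_left)
        (fun i ↦ (hs i).inter K.isCompact.measurableSet)]
    simp_rw [hK]
    refine le_antisymm (iSup_le fun K ↦ ENNReal.tsum_le_tsum fun i ↦
      le_iSup (fun K : TopologicalSpace.Compacts Z ↦ μ (s i ∩ K)) K) ?_
    rw [ENNReal.tsum_eq_iSup_sum]
    refine iSup_le fun t ↦ ?_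
    rw [ENNReal.finsetSum_iSup_of_monotone fun i K K' h ↦ by gcongr]
    exact iSup_mono fun K ↦ ENNReal.sum_le_tsum t

theorem MeasureTheory.Measure.compactPart_apply (μ : Measure Z) {s : Set Z}
    (hs : MeasurableSet s) :
    μ.compactPart s = ⨆ K : TopologicalSpace.Compacts Z, μ (s ∩ K) :=
  Measure.ofMeasurable_apply s hs

theorem MeasureTheory.Measure.compactPart_apply_of_subset (μ : Measure Z) {s K : Set Z}
    (hs : MeasurableSet s) (hK : IsCompact K) (hsK : s ⊆ K) : μ.compactPart s = μ s := by
  rw [μ.compactPart_apply hs]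
  refine le_antisymm (iSup_le fun K ↦ measure_mono Set.inter_subset_left) ?_
  refine le_iSup_of_le ⟨K, hK⟩ ?_
  rw [TopologicalSpace.Compacts.coe_mk, Set.inter_eq_left.2 hsK]

theorem MeasureTheory.Measure.restrict_compactPart (μ : Measure Z) {K : Set Z}
    (hK : IsCompact K) : μ.compactPart.restrict K = μ.restrict K := by
  ext s hs
  rw [Measure.restrict_apply hs, Measure.restrict_apply hs,
    μ.compactPart_apply_of_subset (hs.inter hK.measurableSet) hK Set.inter_subset_right]

instance MeasureTheory.Measure.isFiniteMeasureOnCompacts_compactPart (μ : Measure Z)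
    [IsFiniteMeasureOnCompacts μ] : IsFiniteMeasureOnCompacts μ.compactPart where
  lt_top_of_isCompact K hK := by
    rw [μ.compactPart_apply_of_subset hK.measurableSet hK subset_rfl]
    exact hK.measure_lt_top

instance MeasureTheory.Measure.innerRegular_compactPart (μ : Measure Z) [μ.Regular] :
    μ.compactPart.InnerRegular where
  innerRegular s hs r hr := by
    rw [μ.compactPart_apply hs, lt_iSup_iff] at hr
    obtain ⟨K, hr⟩ := hr
    obtain ⟨K', hK's, hK', hr'⟩ := (hs.inter K.isCompact.measurableSet).exists_lt_isCompact_of_ne_top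
      (measure_mono Set.inter_subset_right |>.trans_lt K.isCompact.measure_lt_top).ne hr
    refine ⟨K', hK's.trans Set.inter_subset_left, hK', ?_⟩
    rwa [μ.compactPart_apply_of_subset hK'.measurableSet hK' subset_rfl]

theorem MeasureTheory.Measure.integral_compactPart (μ : Measure Z) (f : C_c(Z, ℝ)) :
    ∫ z, f z ∂μ.compactPart = ∫ z, f z ∂μ := by
  have h (ν : Measure Z) : ∫ z in tsupport f, f z ∂ν = ∫ z, f z ∂ν :=
    setIntegral_eq_integral_of_forall_compl_eq_zero fun z hz ↦ image_eq_zero_of_notMem_tsupport hz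
  rw [← h, ← h μ, μ.restrict_compactPart f.hasCompactSupport]

end Measure

section Trim

variable {Z : Type*} [TopologicalSpace Z] {m m₀ : MeasurableSpace Z}

theorem MeasureTheory.Measure.InnerRegular.trim {μ : Measure[m₀] Z}
    (hμ : @Measure.InnerRegular Z m₀ _ μ) (hm : m ≤ m₀) :
    @Measure.InnerRegular Z m _ (μ.trim hm) := by
  refine @Measure.InnerRegular.mk Z m _ _ fun s hs r hr ↦ ?_
  rw [trim_measurableSet_eq hm hs] at hr
  obtain ⟨K, hKs, hK, hrK⟩ := hμ.innerRegular (hm s hs) r hr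
  exact ⟨K, hKs, hK, hrK.trans_le (le_trim hm)⟩

end Trim

section Functional

variable {X Y : Type*} [TopologicalSpace X] [TopologicalSpace Y]

/-- A compactly supported function bounded between `0` and `1` and equal to `1` on a given
compact set. -/
theorem CompactlySupportedContinuousMap.exists_eqOn_one [T2Space X] [LocallyCompactSpace X]
    {K : Set X} (hK : IsCompact K) :
    ∃ χ : C_c(X, ℝ), Set.EqOn χ 1 K ∧ ∀ x, χ x ∈ Set.Icc (0 : ℝ) 1 := by
  obtain ⟨χ, h₁, -, h₂, h₃⟩ := exists_continuous_one_zero_of_isCompact hK isClosed_empty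
    (Set.disjoint_empty K)
  exact ⟨⟨χ, h₂⟩, h₁, h₃⟩

/-- A partition of a cutoff function of `K` into pieces along which finitely many functions
vary by at most `ε`. -/
theorem CompactlySupportedContinuousMap.exists_partition [T2Space X] [LocallyCompactSpace X]
    {ι : Type*} (s : Finset ι) (f : ι → C_c(X, ℝ)) (χ : C_c(X, ℝ)) (hχ : ∀ x, 0 ≤ χ x)
    {ε : ℝ} (hε : 0 < ε) :
    ∃ (n : ℕ) (p : Fin n → X) (ψ : Fin n → C_c(X, ℝ)), (∀ j x, 0 ≤ ψ j x) ∧ ∑ j, ψ j = χ ∧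
      ∀ i ∈ s, ∀ j x, |f i x - f i (p j)| * ψ j x ≤ ε * ψ j x := by
  let U (x : X) : Set X := {z | ∀ i ∈ s, |f i z - f i x| < ε}
  have hU (x : X) : IsOpen (U x) := by
    have : U x = ⋂ i ∈ s, {z | |f i z - f i x| < ε} := by ext; simp [U]
    rw [this]
    exact isOpen_biInter_finset fun i _ ↦
      isOpen_lt (((f i).continuous.sub continuous_const).abs) continuous_const
  have hxU (x : X) : x ∈ U x := fun i _ ↦ by simpa using hε
  obtain ⟨t, -, ht⟩ := (show IsCompact (tsupport χ) from χ.hasCompactSupport).elim_nhds_subcover U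
    fun x _ ↦ (hU x).mem_nhds (hxU x)
  let p (j : Fin t.card) : X := t.equivFin.symm j
  obtain ⟨φ, hφU, hφ₁, hφ₀, -⟩ := exists_continuous_sum_one_of_isOpen_isCompact
    (s := fun j ↦ U (p j)) (fun j ↦ hU _) χ.hasCompactSupport <| by
      intro x hx
      obtain ⟨y, hy, hxy⟩ := Set.mem_iUnion₂.1 (ht hx)
      exact Set.mem_iUnion.2 ⟨t.equivFin ⟨y, hy⟩, by simpa [p] using hxy⟩
  refine ⟨t.card, p, fun j ↦ ⟨φ j * χ.toContinuousMap, χ.hasCompactSupport.mul_left⟩,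
    fun j x ↦ mul_nonneg (hφ₀ j x).1 (hχ x), ?_, fun i hi j x ↦ ?_⟩
  · ext x
    rw [CompactlySupportedContinuousMap.sum_apply]
    change ∑ j, φ j x * χ x = χ x
    rw [← Finset.sum_mul]
    by_cases hx : x ∈ tsupport χ
    · have := hφ₁ hx
      rw [Finset.sum_apply] at this
      rw [this, Pi.one_apply, one_mul]
    · rw [image_eq_zero_of_notMem_tsupport hx, mul_zero]
  · change |f i x - f i (p j)| * (φ j x * χ x) ≤ ε * (φ j x * χ x)
    by_cases hx : x ∈ tsupport (φ j)
    · have := hφU j hx i hi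
      have := mul_nonneg (hφ₀ j x).1 (hχ x)
      gcongr
    · simp [image_eq_zero_of_notMem_tsupport hx]

variable (F : C_c(X, ℝ) →ₗ[ℝ] C_c(Y, ℝ) →ₗ[ℝ] ℝ)

/-- A positive bilinear functional satisfies `|F(e, g)| ≤ F(u, v)` when `|e| ≤ u` and `|g| ≤ v`;
this is the lower bound. -/
theorem LinearMap.neg_le_apply_of_abs_le
    (hpos : ∀ f g, (∀ x, 0 ≤ f x) → (∀ y, 0 ≤ g y) → 0 ≤ F f g)
    {e u : C_c(X, ℝ)} {g v : C_c(Y, ℝ)} (he : ∀ x, |e x| ≤ u x) (hg : ∀ y, |g y| ≤ v y) :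
    -F u v ≤ F e g := by
  have h₁ := hpos (u + e) (v + g)
    (fun x ↦ by rw [CompactlySupportedContinuousMap.add_apply]; linarith [(abs_le.1 (he x)).1])
    (fun y ↦ by rw [CompactlySupportedContinuousMap.add_apply]; linarith [(abs_le.1 (hg y)).1])
  have h₂ := hpos (u - e) (v - g)
    (fun x ↦ by rw [CompactlySupportedContinuousMap.sub_apply]; linarith [(abs_le.1 (he x)).2])
    (fun y ↦ by rw [CompactlySupportedContinuousMap.sub_apply]; linarith [(abs_le.1 (hg y)).2])
  simp only [map_add, map_sub, LinearMap.add_apply, LinearMap.sub_apply] at h₁ h₂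
  linarith

/-- A positive bilinear functional is nonnegative on tensors `∑ i, f i ⊗ g i` that are nonnegative
as functions on `X × Y`. -/
theorem LinearMap.sum_apply_nonneg_of_sum_mul_nonneg [T2Space X] [LocallyCompactSpace X]
    (hpos : ∀ f g, (∀ x, 0 ≤ f x) → (∀ y, 0 ≤ g y) → 0 ≤ F f g)
    {ι : Type*} (s : Finset ι) (f : ι → C_c(X, ℝ)) (g : ι → C_c(Y, ℝ))
    (h : ∀ x y, 0 ≤ ∑ i ∈ s, f i x * g i y) : 0 ≤ ∑ i ∈ s, F (f i) (g i) := by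
  obtain ⟨χ, hχ₁, hχ⟩ := exists_eqOn_one (s.isCompact_biUnion fun i _ ↦
    show IsCompact (tsupport (f i)) from (f i).hasCompactSupport)
  let v (i : ι) : C_c(Y, ℝ) := g i ⊔ -g i
  have hv (i : ι) (y : Y) : v i y = |g i y| := rfl
  have hM : 0 ≤ ∑ i ∈ s, F χ (v i) := Finset.sum_nonneg fun i _ ↦
    hpos _ _ (fun x ↦ (hχ x).1) fun y ↦ (hv i y).symm ▸ abs_nonneg _
  suffices H : ∀ ε > 0, -(ε * ∑ i ∈ s, F χ (v i)) ≤ ∑ i ∈ s, F (f i) (g i) by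
    set M := ∑ i ∈ s, F χ (v i)
    refine le_of_forall_pos_le_add fun δ hδ ↦ ?_
    have h₁ := H (δ / (M + 1)) (by positivity)
    have h₂ : δ / (M + 1) * M ≤ δ := by
      rw [div_mul_eq_mul_div, div_le_iff₀ (by positivity)]
      nlinarith
    linarith
  intro ε hε
  obtain ⟨n, p, ψ, hψ₀, hψ, hψε⟩ := exists_partition s f χ (fun x ↦ (hχ x).1) hε
  have hf {i : ι} (hi : i ∈ s) : f i = ∑ j, f i * ψ j := by
    rw [← Finset.mul_sum, hψ]
    ext x
    rw [CompactlySupportedContinuousMap.mul_apply]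
    by_cases hx : x ∈ tsupport (f i)
    · rw [hχ₁ (Set.mem_biUnion hi hx), Pi.one_apply, mul_one]
    · rw [image_eq_zero_of_notMem_tsupport hx, zero_mul]
  have key : ∀ i ∈ s, -(ε * F χ (v i)) + ∑ j, f i (p j) * F (ψ j) (g i) ≤ F (f i) (g i) := by
    intro i hi
    conv_rhs => rw [hf hi]
    rw [← hψ]
    simp only [map_sum, LinearMap.sum_apply]
    rw [Finset.mul_sum, ← Finset.sum_neg_distrib, ← Finset.sum_add_distrib]
    refine Finset.sum_le_sum fun j _ ↦ ?_
    have := F.neg_le_apply_of_abs_le hpos (e := f i * ψ j - f i (p j) • ψ j) (u := ε • ψ j)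
      (g := g i) (v := v i) (fun x ↦ ?_) (fun y ↦ (hv i y).ge)
    · simp only [map_sub, map_smul, LinearMap.sub_apply, LinearMap.smul_apply, smul_eq_mul] at this
      linarith
    · rw [CompactlySupportedContinuousMap.sub_apply, CompactlySupportedContinuousMap.mul_apply,
        CompactlySupportedContinuousMap.smul_apply, CompactlySupportedContinuousMap.smul_apply,
        smul_eq_mul, smul_eq_mul, ← sub_mul, abs_mul, abs_of_nonneg (hψ₀ j x)]
      exact hψε i hi j x
  refine le_trans ?_ (Finset.sum_le_sum key)
  rw [Finset.sum_add_distrib, Finset.sum_neg_distrib, ← Finset.mul_sum, Finset.sum_comm]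
  refine le_add_of_nonneg_right (Finset.sum_nonneg fun j _ ↦ ?_)
  have := hpos (ψ j) (∑ i ∈ s, f i (p j) • g i) (hψ₀ j) fun y ↦ by
    simpa [CompactlySupportedContinuousMap.sum_apply] using h (p j) y
  simpa using this

instance CompactlySupportedContinuousMap.posSMulMono : PosSMulMono ℝ C_c(X, ℝ) where
  smul_le_smul_of_nonneg_left _ hc _ _ h x := mul_le_mul_of_nonneg_left (h x) hc

/-- The product `(x, y) ↦ f x * g y` of compactly supported functions, as a bilinear map. -/
def CompactlySupportedContinuousMap.prodMul [T2Space X] [T2Space Y] :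
    C_c(X, ℝ) →ₗ[ℝ] C_c(Y, ℝ) →ₗ[ℝ] C_c(X × Y, ℝ) :=
  LinearMap.mk₂ ℝ
    (fun f g ↦ ⟨⟨fun q ↦ f q.1 * g q.2, by fun_prop⟩,
      HasCompactSupport.intro (f.hasCompactSupport.isCompact.prod g.hasCompactSupport.isCompact)
        fun q hq ↦ by
          rw [Set.mem_prod, not_and_or] at hq
          rcases hq with hq | hq <;> simp [image_eq_zero_of_notMem_tsupport hq]⟩)
    (fun f f' g ↦ by ext; simp [add_mul]) (fun c f g ↦ by ext; simp [mul_assoc])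
    (fun f g g' ↦ by ext; simp [mul_add]) (fun c f g ↦ by ext; simp [mul_left_comm])

@[simp]
theorem CompactlySupportedContinuousMap.prodMul_apply [T2Space X] [T2Space Y] (f : C_c(X, ℝ))
    (g : C_c(Y, ℝ)) (q : X × Y) : prodMul f g q = f q.1 * g q.2 := rfl

/-- A positive bilinear functional is nonnegative on the tensors that induce nonnegative functions
on `X × Y`. -/
theorem LinearMap.lift_nonneg_of_lift_prodMul_nonneg [T2Space X] [LocallyCompactSpace X]
    [T2Space Y] (hpos : ∀ f g, (∀ x, 0 ≤ f x) → (∀ y, 0 ≤ g y) → 0 ≤ F f g)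
    (u : C_c(X, ℝ) ⊗[ℝ] C_c(Y, ℝ))
    (hu : TensorProduct.lift prodMul u ∈ PointedCone.positive ℝ C_c(X × Y, ℝ)) :
    0 ≤ TensorProduct.lift F u := by
  obtain ⟨s, rfl⟩ := TensorProduct.exists_finset u
  rw [PointedCone.mem_positive, CompactlySupportedContinuousMap.le_def] at hu
  simp only [map_sum, TensorProduct.lift.tmul] at hu ⊢
  refine F.sum_apply_nonneg_of_sum_mul_nonneg hpos s Prod.fst Prod.snd fun x y ↦ ?_
  simpa [CompactlySupportedContinuousMap.sum_apply] using hu (x, y)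

/-- Tensors are cofinal in `C_c(X × Y)`. -/
theorem CompactlySupportedContinuousMap.exists_lift_prodMul_add_nonneg [T2Space X]
    [LocallyCompactSpace X] [T2Space Y] [LocallyCompactSpace Y] (h : C_c(X × Y, ℝ)) :
    ∃ u : C_c(X, ℝ) ⊗[ℝ] C_c(Y, ℝ),
      TensorProduct.lift prodMul u + h ∈ PointedCone.positive ℝ C_c(X × Y, ℝ) := by
  obtain ⟨C, hC⟩ := h.continuous.bounded_above_of_compact_support h.hasCompactSupport
  have hK : IsCompact (tsupport h) := h.hasCompactSupport
  obtain ⟨χ, hχ₁, hχ⟩ := exists_eqOn_one (hK.image continuous_fst)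
  obtain ⟨θ, hθ₁, hθ⟩ := exists_eqOn_one (hK.image continuous_snd)
  refine ⟨(|C| • χ) ⊗ₜ θ, ?_⟩
  rw [PointedCone.mem_positive, CompactlySupportedContinuousMap.le_def]
  intro q
  simp only [TensorProduct.lift.tmul, CompactlySupportedContinuousMap.add_apply, prodMul_apply,
    CompactlySupportedContinuousMap.smul_apply, smul_eq_mul, CompactlySupportedContinuousMap.zero_apply]
  by_cases hq : q ∈ tsupport h
  · rw [hχ₁ (Set.mem_image_of_mem _ hq), hθ₁ (Set.mem_image_of_mem _ hq)]
    have : -C ≤ h q := (abs_le.1 (hC q)).1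
    simp only [Pi.one_apply, mul_one]
    linarith [le_abs_self C]
  · rw [image_eq_zero_of_notMem_tsupport hq, add_zero]
    exact mul_nonneg (mul_nonneg (abs_nonneg C) (hχ _).1) (hθ _).1

/-- A positive bilinear functional on `C_c(X) × C_c(Y)` extends to a positive linear functional
on `C_c(X × Y)`. -/
theorem LinearMap.exists_positiveLinearMap_prodMul [T2Space X] [LocallyCompactSpace X] [T2Space Y]
    [LocallyCompactSpace Y] (hpos : ∀ f g, (∀ x, 0 ≤ f x) → (∀ y, 0 ≤ g y) → 0 ≤ F f g) :
    ∃ Λ : C_c(X × Y, ℝ) →ₚ[ℝ] ℝ, ∀ f g, Λ (prodMul f g) = F f g := by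
  obtain ⟨G, hGF, hG⟩ := PointedCone.exists_nonneg_comp_eq (V := C_c(X, ℝ) ⊗[ℝ] C_c(Y, ℝ))
    (PointedCone.positive ℝ C_c(X × Y, ℝ)) (TensorProduct.lift prodMul) (TensorProduct.lift F)
    (F.lift_nonneg_of_lift_prodMul_nonneg hpos) fun h ↦ by
      obtain ⟨u, hu⟩ := exists_lift_prodMul_add_nonneg h
      exact ⟨u, hu⟩
  refine ⟨PositiveLinearMap.mk₀ G fun h hh ↦ hG h hh, fun f g ↦ ?_⟩
  have hfg := hGF (f ⊗ₜ g)
  simp only [TensorProduct.lift.tmul] at hfg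
  exact hfg

end Functional

/-- **Riesz–Markov–Kakutani** with an inner regular representing measure. -/
theorem PositiveLinearMap.exists_innerRegular_integral_eq {Z : Type*} [TopologicalSpace Z]
    [T2Space Z] [LocallyCompactSpace Z] [MeasurableSpace Z] [BorelSpace Z]
    (Λ : C_c(Z, ℝ) →ₚ[ℝ] ℝ) :
    ∃ μ : Measure Z, IsFiniteMeasureOnCompacts μ ∧ μ.InnerRegular ∧
      ∀ f : C_c(Z, ℝ), ∫ z, f z ∂μ = Λ f :=
  ⟨(RealRMK.rieszMeasure Λ).compactPart, inferInstance, inferInstance, fun f ↦ by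
    rw [Measure.integral_compactPart, RealRMK.integral_rieszMeasure]⟩

/-- Riesz-type representation of locally bounded nonnegative bilinear functionals on
`C₀(X) × C₀(Y)` (compactly supported continuous functions) for locally compact Hausdorff
`X`, `Y` by nonnegative Radon measures on `X × Y` that are finite on compact sets. -/
theorem stmt_13 (X Y : Type*)
    [TopologicalSpace X] [LocallyCompactSpace X] [T2Space X]
    [TopologicalSpace Y] [LocallyCompactSpace Y] [T2Space Y]
    [MeasurableSpace X] [BorelSpace X] [MeasurableSpace Y] [BorelSpace Y]
    (F : C_c(X, ℝ) →ₗ[ℝ] C_c(Y, ℝ) →ₗ[ℝ] ℝ)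
    (hbound : ∀ (K₁ : Set X) (K₂ : Set Y), IsCompact K₁ → IsCompact K₂ →
      ∃ C : ℝ, ∀ (f : C_c(X, ℝ)) (g : C_c(Y, ℝ)),
        tsupport f ⊆ K₁ → tsupport g ⊆ K₂ →
          |F f g| ≤ C * (⨆ x, |f x|) * (⨆ y, |g y|))
    (hpos : ∀ (f : C_c(X, ℝ)) (g : C_c(Y, ℝ)),
      (∀ x, 0 ≤ f x) → (∀ y, 0 ≤ g y) → 0 ≤ F f g) :
    ∃ μ : Measure (X × Y), IsFiniteMeasureOnCompacts μ ∧ μ.InnerRegular ∧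
      ∀ (f : C_c(X, ℝ)) (g : C_c(Y, ℝ)), F f g = ∫ p, f p.1 * g p.2 ∂μ := by
  obtain ⟨Λ, hΛ⟩ := F.exists_positiveLinearMap_prodMul hpos
  have hm : (Prod.instMeasurableSpace : MeasurableSpace (X × Y)) ≤ borel (X × Y) :=
    prod_le_borel_prod
  obtain ⟨μ, hfin, hreg, hμ⟩ :=
    @PositiveLinearMap.exists_innerRegular_integral_eq (X × Y) _ _ _ (borel (X × Y))
      (@BorelSpace.mk _ _ (borel (X × Y)) rfl) Λ
  refine ⟨μ.trim hm, ⟨fun K hK ↦ ?_⟩, hreg.trim hm, fun f g ↦ ?_⟩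
  · have hK₁ := hK.image continuous_fst
    have hK₂ := hK.image continuous_snd
    refine (measure_mono Set.subset_fst_image_prod_snd_image).trans_lt ?_
    rw [trim_measurableSet_eq hm (hK₁.measurableSet.prod hK₂.measurableSet)]
    exact hfin.lt_top_of_isCompact (hK₁.prod hK₂)
  · have hfg : Measurable fun q : X × Y ↦ f q.1 * g q.2 :=
      (f.continuous.measurable.comp measurable_fst).mul (g.continuous.measurable.comp measurable_snd)
    rw [← integral_trim hm hfg.stronglyMeasurable, ← hΛ, ← hμ]
    rfl
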